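/- arXiv:2209.10805 — 2 statements merged into one kernel-verified Lean document; each statement's English description precedes it below -/
import Mathlib

section
/- Let M be a feasible matching in a marriage instance with critical men, and suppose some level assignment satisfies the dominant conditions for M. Then M is a popular feasible matching, i.e., φ(N,M) ≤ φ(M,N) for every feasible matching N. -/
open Classical

universe u v

/-- A marriage instance with critical men: a finite bipartite graph with edge set `E ⊆ A × B`,
a set `C ⊆ A` of critical men, and strict preference orders of each vertex over its
neighbours (`prefA m w w'` : man `m` strictly prefers woman `w` to woman `w'`;
`prefB w m m'` : woman `w` strictly prefers man `m` to man `m'`). -/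
structure CritInstance (A : Type u) (B : Type v) where
  E : Finset (A × B)
  C : Finset A
  prefA : A → B → B → Prop
  prefB : B → A → A → Prop
  prefA_irrefl : ∀ m w, ¬ prefA m w w
  prefA_trans : ∀ m w₁ w₂ w₃, prefA m w₁ w₂ → prefA m w₂ w₃ → prefA m w₁ w₃
  prefA_total : ∀ m w₁ w₂, (m, w₁) ∈ E → (m, w₂) ∈ E → w₁ ≠ w₂ →
    prefA m w₁ w₂ ∨ prefA m w₂ w₁
  prefB_irrefl : ∀ w m, ¬ prefB w m m
  prefB_trans : ∀ w m₁ m₂ m₃, prefB w m₁ m₂ → prefB w m₂ m₃ → prefB w m₁ m₃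
  prefB_total : ∀ w m₁ m₂, (m₁, w) ∈ E → (m₂, w) ∈ E → m₁ ≠ m₂ →
    prefB w m₁ m₂ ∨ prefB w m₂ m₁

namespace CritInstance

variable {A : Type u} {B : Type v}

/-- `M` is a matching: a set of edges in which every vertex has at most one partner. -/
def IsMatching (I : CritInstance A B) (M : Finset (A × B)) : Prop :=
  M ⊆ I.E ∧ (∀ ⦃m w w'⦄, (m, w) ∈ M → (m, w') ∈ M → w = w') ∧
    (∀ ⦃m m' w⦄, (m, w) ∈ M → (m', w) ∈ M → m = m')

/-- Man `m` is matched in `M`. -/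
def ManMatched (M : Finset (A × B)) (m : A) : Prop := ∃ w, (m, w) ∈ M

/-- Woman `w` is matched in `M`. -/
def WomanMatched (M : Finset (A × B)) (w : B) : Prop := ∃ m, (m, w) ∈ M

/-- `M` is feasible: it is a matching and every critical man is matched. -/
def IsFeasible (I : CritInstance A B) (M : Finset (A × B)) : Prop :=
  IsMatching I M ∧ ∀ m ∈ I.C, ManMatched M m

/-- Man `m` prefers matching `M` to matching `N`: he is matched in `M` and either
unmatched in `N` or strictly prefers his `M`-partner to his `N`-partner. -/
def ManPrefers (I : CritInstance A B) (M N : Finset (A × B)) (m : A) : Prop :=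
  ∃ w, (m, w) ∈ M ∧ (¬ ManMatched N m ∨ ∃ w', (m, w') ∈ N ∧ I.prefA m w w')

/-- Woman `w` prefers matching `M` to matching `N`. -/
def WomanPrefers (I : CritInstance A B) (M N : Finset (A × B)) (w : B) : Prop :=
  ∃ m, (m, w) ∈ M ∧ (¬ WomanMatched N w ∨ ∃ m', (m', w) ∈ N ∧ I.prefB w m m')

/-- `phi I M N` is the number of vertices that prefer `M` to `N`. -/
noncomputable def phi [Fintype A] [Fintype B] (I : CritInstance A B)
    (M N : Finset (A × B)) : ℕ :=
  (Finset.univ.filter fun m : A => ManPrefers I M N m).card +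
    (Finset.univ.filter fun w : B => WomanPrefers I M N w).card

/-- `M` is a popular feasible matching. -/
def IsPFM [Fintype A] [Fintype B] (I : CritInstance A B) (M : Finset (A × B)) : Prop :=
  IsFeasible I M ∧ ∀ N, IsFeasible I N → phi I N M ≤ phi I M N

/-- `M` is a minimum size popular feasible matching. -/
def IsMinPFM [Fintype A] [Fintype B] (I : CritInstance A B) (M : Finset (A × B)) : Prop :=
  IsPFM I M ∧ ∀ N, IsPFM I N → M.card ≤ N.card

/-- `M` is a dominant feasible matching. -/
def IsDFM [Fintype A] [Fintype B] (I : CritInstance A B) (M : Finset (A × B)) : Prop :=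
  IsPFM I M ∧ ∀ N, IsFeasible I N → M.card < N.card → phi I N M < phi I M N

/-- `(m,w)` is a `(+1,+1)` edge with respect to `M`: an edge of `E ∖ M` such that `m` is
unmatched or prefers `w` to his partner, and `w` is unmatched or prefers `m` to her partner. -/
def PlusPlus (I : CritInstance A B) (M : Finset (A × B)) (m : A) (w : B) : Prop :=
  (m, w) ∈ I.E ∧ (m, w) ∉ M ∧
    (¬ ManMatched M m ∨ ∃ w', (m, w') ∈ M ∧ I.prefA m w w') ∧
    (¬ WomanMatched M w ∨ ∃ m', (m', w) ∈ M ∧ I.prefB w m m')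

/-- `(m,w)` is a `(−1,−1)` edge with respect to `M`: an edge of `E ∖ M` such that `m` is
matched and prefers his partner to `w`, and `w` is matched and prefers her partner to `m`. -/
def MinusMinus (I : CritInstance A B) (M : Finset (A × B)) (m : A) (w : B) : Prop :=
  (m, w) ∈ I.E ∧ (m, w) ∉ M ∧
    (∃ w', (m, w') ∈ M ∧ I.prefA m w' w) ∧
    (∃ m', (m', w) ∈ M ∧ I.prefB w m' m)

/-- `M` is a stable matching: a matching with no blocking pair. -/
def IsStable (I : CritInstance A B) (M : Finset (A × B)) : Prop :=
  IsMatching I M ∧ ∀ m w, ¬ PlusPlus I M m w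

/-- The min-size conditions for a level assignment `(lA, lB)` with respect to `M`:
(i) matched partners share a level, unmatched vertices have level 0, non-critical men
have level 0; (ii) every `(+1,+1)` edge goes from a man to a strictly higher level woman;
(iii) every edge from a man at level `i` to a woman at level `i − 1` is a `(−1,−1)` edge;
(iv) no edge goes from a man at level `i` to a woman at level `≤ i − 2`. -/
def MinSizeConds (I : CritInstance A B) (M : Finset (A × B))
    (lA : A → ℕ) (lB : B → ℕ) : Prop :=
  (∀ m w, (m, w) ∈ M → lA m = lB w) ∧
  (∀ m, ¬ ManMatched M m → lA m = 0) ∧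
  (∀ w, ¬ WomanMatched M w → lB w = 0) ∧
  (∀ m, m ∉ I.C → lA m = 0) ∧
  (∀ m w, PlusPlus I M m w → lA m < lB w) ∧
  (∀ m w, (m, w) ∈ I.E → lB w + 1 = lA m → MinusMinus I M m w) ∧
  (∀ m w, (m, w) ∈ I.E → ¬ (lB w + 2 ≤ lA m))

/-- The dominant conditions for a level assignment `(lA, lB)` with respect to `M`:
(i) matched partners share a level, unmatched women have level 0, unmatched men have
level 1, non-critical men have level at most 1; (ii)–(iv) as in the min-size conditions. -/
def DomConds (I : CritInstance A B) (M : Finset (A × B))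
    (lA : A → ℕ) (lB : B → ℕ) : Prop :=
  (∀ m w, (m, w) ∈ M → lA m = lB w) ∧
  (∀ m, ¬ ManMatched M m → lA m = 1) ∧
  (∀ w, ¬ WomanMatched M w → lB w = 0) ∧
  (∀ m, m ∉ I.C → lA m ≤ 1) ∧
  (∀ m w, PlusPlus I M m w → lA m < lB w) ∧
  (∀ m w, (m, w) ∈ I.E → lB w + 1 = lA m → MinusMinus I M m w) ∧
  (∀ m w, (m, w) ∈ I.E → ¬ (lB w + 2 ≤ lA m))

/-- Adjacency in the bipartite graph, on the vertex set `A ⊕ B`. -/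
def Adj (I : CritInstance A B) : A ⊕ B → A ⊕ B → Prop
  | Sum.inl m, Sum.inr w => (m, w) ∈ I.E
  | Sum.inr w, Sum.inl m => (m, w) ∈ I.E
  | _, _ => False

/-- The (directed) pair `(u, v)` of vertices spans an edge of the matching `M`. -/
def StepM (M : Finset (A × B)) : A ⊕ B → A ⊕ B → Prop
  | Sum.inl m, Sum.inr w => (m, w) ∈ M
  | Sum.inr w, Sum.inl m => (m, w) ∈ M
  | _, _ => False

/-- The pair `(u, v)` of vertices spans a `(+1,+1)` edge with respect to `M`. -/
def StepPP (I : CritInstance A B) (M : Finset (A × B)) : A ⊕ B → A ⊕ B → Prop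
  | Sum.inl m, Sum.inr w => PlusPlus I M m w
  | Sum.inr w, Sum.inl m => PlusPlus I M m w
  | _, _ => False

/-- The pair `(u, v)` of vertices spans a `(−1,−1)` edge with respect to `M`. -/
def StepMM (I : CritInstance A B) (M : Finset (A × B)) : A ⊕ B → A ⊕ B → Prop
  | Sum.inl m, Sum.inr w => MinusMinus I M m w
  | Sum.inr w, Sum.inl m => MinusMinus I M m w
  | _, _ => False

/-- A vertex of `A ⊕ B` is matched in `M`. -/
def VMatched (M : Finset (A × B)) : A ⊕ B → Prop
  | Sum.inl m => ManMatched M m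
  | Sum.inr w => WomanMatched M w

/-- An `M`-alternating path in the graph: a sequence of distinct vertices
`vert 0, …, vert len` (`len ≥ 1` edges), consecutive vertices adjacent, with
consecutive edges alternately inside and outside `M`. -/
structure AltPath (I : CritInstance A B) (M : Finset (A × B)) where
  len : ℕ
  len_pos : 0 < len
  vert : ℕ → A ⊕ B
  inj : ∀ i j, i ≤ len → j ≤ len → vert i = vert j → i = j
  adj : ∀ i, i < len → Adj I (vert i) (vert (i + 1))
  alternate : ∀ i, i + 1 < len →
    (StepM M (vert i) (vert (i + 1)) ↔ ¬ StepM M (vert (i + 1)) (vert (i + 2)))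

namespace AltPath

variable {I : CritInstance A B} {M : Finset (A × B)}

/-- The number of `(+1,+1)` edges of the path. -/
noncomputable def countPP (ρ : AltPath I M) : ℕ :=
  ((Finset.range ρ.len).filter fun i => StepPP I M (ρ.vert i) (ρ.vert (i + 1))).card

/-- The number of `(−1,−1)` edges of the path. -/
noncomputable def countMM (ρ : AltPath I M) : ℕ :=
  ((Finset.range ρ.len).filter fun i => StepMM I M (ρ.vert i) (ρ.vert (i + 1))).card

/-- The vertex `u` lies on the path. -/
def Mem (ρ : AltPath I M) (u : A ⊕ B) : Prop := ∃ i ≤ ρ.len, ρ.vert i = u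

/-- The set of edges of the path, as a set of pairs in `A × B`. -/
noncomputable def edges (ρ : AltPath I M) : Finset (A × B) :=
  I.E.filter fun e => ∃ i < ρ.len,
    (ρ.vert i = Sum.inl e.1 ∧ ρ.vert (i + 1) = Sum.inr e.2) ∨
    (ρ.vert i = Sum.inr e.2 ∧ ρ.vert (i + 1) = Sum.inl e.1)

end AltPath

/-- An `M`-alternating cycle: a closed sequence of vertices `vert 0, …, vert len = vert 0`
(distinct except for the return), consecutive vertices adjacent, with edges alternately
inside and outside `M`, including around the wrap. -/
structure AltCycle (I : CritInstance A B) (M : Finset (A × B)) where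
  len : ℕ
  len_pos : 0 < len
  vert : ℕ → A ⊕ B
  closed : vert len = vert 0
  inj : ∀ i j, i < len → j < len → vert i = vert j → i = j
  adj : ∀ i, i < len → Adj I (vert i) (vert (i + 1))
  alternate : ∀ i, i + 1 < len →
    (StepM M (vert i) (vert (i + 1)) ↔ ¬ StepM M (vert (i + 1)) (vert (i + 2)))
  alternate_wrap : StepM M (vert (len - 1)) (vert len) ↔ ¬ StepM M (vert 0) (vert 1)

namespace AltCycle

variable {I : CritInstance A B} {M : Finset (A × B)}

/-- The number of `(+1,+1)` edges of the cycle. -/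
noncomputable def countPP (σ : AltCycle I M) : ℕ :=
  ((Finset.range σ.len).filter fun i => StepPP I M (σ.vert i) (σ.vert (i + 1))).card

/-- The number of `(−1,−1)` edges of the cycle. -/
noncomputable def countMM (σ : AltCycle I M) : ℕ :=
  ((Finset.range σ.len).filter fun i => StepMM I M (σ.vert i) (σ.vert (i + 1))).card

end AltCycle

/-- A size-increasing alternating path (SIAP) for `M`: an `M`-alternating path whose two
endpoints are a man unmatched in `M` and a woman unmatched in `M`, and which has equally
many `(+1,+1)` and `(−1,−1)` edges. -/
def IsSIAP (I : CritInstance A B) (M : Finset (A × B)) (ρ : AltPath I M) : Prop :=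
  (((∃ m, ρ.vert 0 = Sum.inl m ∧ ¬ ManMatched M m) ∧
      (∃ w, ρ.vert ρ.len = Sum.inr w ∧ ¬ WomanMatched M w)) ∨
    ((∃ w, ρ.vert 0 = Sum.inr w ∧ ¬ WomanMatched M w) ∧
      (∃ m, ρ.vert ρ.len = Sum.inl m ∧ ¬ ManMatched M m))) ∧
  ρ.countPP = ρ.countMM

/-- A size-reducing alternating path (SRAP) for `M` with respect to the level assignment
`(lA, lB)`: an `M`-alternating path both of whose terminal edges lie in `M`, starting at a
woman matched in `M` at level 0, ending at a non-critical man at level 1, whose number of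
`(+1,+1)` edges is exactly one more than its number of `(−1,−1)` edges. -/
def IsSRAP (I : CritInstance A B) (M : Finset (A × B)) (lA : A → ℕ) (lB : B → ℕ)
    (ρ : AltPath I M) : Prop :=
  StepM M (ρ.vert 0) (ρ.vert 1) ∧
  StepM M (ρ.vert (ρ.len - 1)) (ρ.vert ρ.len) ∧
  (((∃ w, ρ.vert 0 = Sum.inr w ∧ WomanMatched M w ∧ lB w = 0) ∧
      (∃ m, ρ.vert ρ.len = Sum.inl m ∧ m ∉ I.C ∧ lA m = 1)) ∨
    ((∃ m, ρ.vert 0 = Sum.inl m ∧ m ∉ I.C ∧ lA m = 1) ∧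
      (∃ w, ρ.vert ρ.len = Sum.inr w ∧ WomanMatched M w ∧ lB w = 0))) ∧
  ρ.countPP = ρ.countMM + 1

end CritInstance

namespace CritInstance

variable {A : Type u} {B : Type v}

/-- Weak LP duality for matchings: vertex weights that are nonpositive on every edge of a
matching and on every vertex it leaves uncovered have nonpositive total. -/
theorem IsMatching.sum_add_sum_nonpos [Fintype A] [Fintype B] {I : CritInstance A B}
    {N : Finset (A × B)} (hN : I.IsMatching N) (F : A → ℤ) (G : B → ℤ)
    (hF : ∀ m, ¬ ManMatched N m → F m ≤ 0) (hG : ∀ w, ¬ WomanMatched N w → G w ≤ 0)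
    (hFG : ∀ m w, (m, w) ∈ N → F m + G w ≤ 0) :
    ∑ m, F m + ∑ w, G w ≤ 0 := by
  have h₁ : ∑ m, F m ≤ ∑ e ∈ N, F e.1 := by
    rw [← Finset.sum_image (s := N) (g := Prod.fst) (f := F)]
    · rw [← Finset.sum_add_sum_compl (N.image Prod.fst) F]
      have : ∑ m ∈ (N.image Prod.fst)ᶜ, F m ≤ 0 := by
        refine Finset.sum_nonpos fun m hm => hF m ?_
        rintro ⟨w, hw⟩
        exact Finset.mem_compl.1 hm (Finset.mem_image_of_mem Prod.fst hw)
      linarith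
    · rintro ⟨m, w⟩ he ⟨m', w'⟩ he' (rfl : m = m')
      rw [hN.2.1 he he']
  have h₂ : ∑ w, G w ≤ ∑ e ∈ N, G e.2 := by
    rw [← Finset.sum_image (s := N) (g := Prod.snd) (f := G)]
    · rw [← Finset.sum_add_sum_compl (N.image Prod.snd) G]
      have : ∑ w ∈ (N.image Prod.snd)ᶜ, G w ≤ 0 := by
        refine Finset.sum_nonpos fun w hw => hG w ?_
        rintro ⟨m, hm⟩
        exact Finset.mem_compl.1 hw (Finset.mem_image_of_mem Prod.snd hm)
      linarith
    · rintro ⟨m, w⟩ he ⟨m', w'⟩ he' (rfl : w = w')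
      rw [hN.2.2 he he']
  have h₃ : ∑ e ∈ N, (F e.1 + G e.2) ≤ 0 := Finset.sum_nonpos fun e he => hFG e.1 e.2 he
  rw [Finset.sum_add_distrib] at h₃
  linarith

/-- The vote of man `m` for `N` against `M`. -/
noncomputable def manVote (I : CritInstance A B) (N M : Finset (A × B)) (m : A) : ℤ :=
  (if ManPrefers I N M m then 1 else 0) - (if ManPrefers I M N m then 1 else 0)

/-- The vote of woman `w` for `N` against `M`. -/
noncomputable def womanVote (I : CritInstance A B) (N M : Finset (A × B)) (w : B) : ℤ :=
  (if WomanPrefers I N M w then 1 else 0) - (if WomanPrefers I M N w then 1 else 0)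

theorem sum_manVote_add_sum_womanVote [Fintype A] [Fintype B] (I : CritInstance A B)
    (N M : Finset (A × B)) :
    ∑ m, manVote I N M m + ∑ w, womanVote I N M w = (phi I N M : ℤ) - phi I M N := by
  simp only [manVote, womanVote, phi, Finset.sum_sub_distrib, Finset.sum_boole, Nat.cast_add]
  ring

section Votes

variable {I : CritInstance A B} {M N : Finset (A × B)} {m : A} {w : B}

theorem manVote_le_one : manVote I N M m ≤ 1 := by
  unfold manVote; split_ifs <;> simp

theorem womanVote_le_one : womanVote I N M w ≤ 1 := by
  unfold womanVote; split_ifs <;> simp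

theorem manVote_eq_neg_one (h : ManPrefers I M N m) (h' : ¬ ManPrefers I N M m) :
    manVote I N M m = -1 := by
  simp [manVote, h, h']

theorem womanVote_eq_neg_one (h : WomanPrefers I M N w) (h' : ¬ WomanPrefers I N M w) :
    womanVote I N M w = -1 := by
  simp [womanVote, h, h']

theorem manVote_of_not_matched (hN : ¬ ManMatched N m) (hM : ManMatched M m) :
    manVote I N M m = -1 := by
  obtain ⟨w, hw⟩ := hM
  exact manVote_eq_neg_one ⟨w, hw, .inl hN⟩ fun ⟨w', hw', _⟩ => hN ⟨w', hw'⟩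

theorem womanVote_of_not_matched (hN : ¬ WomanMatched N w) (hM : WomanMatched M w) :
    womanVote I N M w = -1 := by
  obtain ⟨m, hm⟩ := hM
  exact womanVote_eq_neg_one ⟨m, hm, .inl hN⟩ fun ⟨m', hm', _⟩ => hN ⟨m', hm'⟩

theorem manVote_of_not_matched_of_not_matched (hN : ¬ ManMatched N m) (hM : ¬ ManMatched M m) :
    manVote I N M m = 0 := by
  have h₁ : ¬ ManPrefers I N M m := fun ⟨w, hw, _⟩ => hN ⟨w, hw⟩
  have h₂ : ¬ ManPrefers I M N m := fun ⟨w, hw, _⟩ => hM ⟨w, hw⟩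
  simp [manVote, h₁, h₂]

theorem womanVote_of_not_matched_of_not_matched (hN : ¬ WomanMatched N w)
    (hM : ¬ WomanMatched M w) : womanVote I N M w = 0 := by
  have h₁ : ¬ WomanPrefers I N M w := fun ⟨m, hm, _⟩ => hN ⟨m, hm⟩
  have h₂ : ¬ WomanPrefers I M N w := fun ⟨m, hm, _⟩ => hM ⟨m, hm⟩
  simp [womanVote, h₁, h₂]

theorem not_manPrefers_of_mem (hM : I.IsMatching M) (hN : I.IsMatching N) (h : (m, w) ∈ M)
    (h' : (m, w) ∈ N) : ¬ ManPrefers I N M m := by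
  rintro ⟨w₁, hw₁, hn | ⟨w₂, hw₂, hp⟩⟩
  · exact hn ⟨w, h⟩
  · rw [hN.2.1 hw₁ h', hM.2.1 hw₂ h] at hp
    exact I.prefA_irrefl _ _ hp

theorem not_womanPrefers_of_mem (hM : I.IsMatching M) (hN : I.IsMatching N) (h : (m, w) ∈ M)
    (h' : (m, w) ∈ N) : ¬ WomanPrefers I N M w := by
  rintro ⟨m₁, hm₁, hn | ⟨m₂, hm₂, hp⟩⟩
  · exact hn ⟨m, h⟩
  · rw [hN.2.2 hm₁ h', hM.2.2 hm₂ h] at hp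
    exact I.prefB_irrefl _ _ hp

theorem manVote_of_prefA (hM : I.IsMatching M) (hN : I.IsMatching N) {w' : B}
    (h : (m, w) ∈ N) (h' : (m, w') ∈ M) (hp : I.prefA m w' w) : manVote I N M m = -1 := by
  refine manVote_eq_neg_one ⟨w', h', .inr ⟨w, h, hp⟩⟩ ?_
  rintro ⟨w₁, hw₁, hn | ⟨w₂, hw₂, hq⟩⟩
  · exact hn ⟨w', h'⟩
  · rw [hN.2.1 hw₁ h, hM.2.1 hw₂ h'] at hq
    exact I.prefA_irrefl _ _ (I.prefA_trans _ _ _ _ hp hq)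

theorem womanVote_of_prefB (hM : I.IsMatching M) (hN : I.IsMatching N) {m' : A}
    (h : (m, w) ∈ N) (h' : (m', w) ∈ M) (hp : I.prefB w m' m) : womanVote I N M w = -1 := by
  refine womanVote_eq_neg_one ⟨m', h', .inr ⟨m, h, hp⟩⟩ ?_
  rintro ⟨m₁, hm₁, hn | ⟨m₂, hm₂, hq⟩⟩
  · exact hn ⟨m', h'⟩
  · rw [hN.2.2 hm₁ h, hM.2.2 hm₂ h'] at hq
    exact I.prefB_irrefl _ _ (I.prefB_trans _ _ _ _ hp hq)

/-- An edge of `N ∖ M` that is not a `(+1,+1)` edge has an endpoint voting against `N`. -/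
theorem manVote_or_womanVote_of_not_plusPlus (hM : I.IsMatching M) (hN : I.IsMatching N)
    (h : (m, w) ∈ N) (h' : (m, w) ∉ M) (hpp : ¬ PlusPlus I M m w) :
    manVote I N M m = -1 ∨ womanVote I N M w = -1 := by
  by_contra! hv
  refine hpp ⟨hN.1 h, h', or_iff_not_imp_left.2 fun hm => ?_, or_iff_not_imp_left.2 fun hw => ?_⟩
  · obtain ⟨w', hw'⟩ := not_not.1 hm
    refine ⟨w', hw', (I.prefA_total m w w' (hN.1 h) (hM.1 hw') ?_).resolve_right fun hp =>
      hv.1 (manVote_of_prefA hM hN h hw' hp)⟩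
    rintro rfl
    exact h' hw'
  · obtain ⟨m', hm'⟩ := not_not.1 hw
    refine ⟨m', hm', (I.prefB_total w m m' (hN.1 h) (hM.1 hm') ?_).resolve_right fun hp =>
      hv.2 (womanVote_of_prefB hM hN h hm' hp)⟩
    rintro rfl
    exact h' hm'

/-- Under the dominant conditions, the votes of the endpoints of an edge of `N` are bounded by
twice the level difference. -/
theorem DomConds.manVote_add_womanVote_le {lA : A → ℕ} {lB : B → ℕ} (hl : I.DomConds M lA lB)
    (hM : I.IsMatching M) (hN : I.IsMatching N) (h : (m, w) ∈ N) :
    manVote I N M m + womanVote I N M w ≤ 2 * ((lB w : ℤ) - lA m) := by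
  obtain ⟨hMl, -, -, -, hpp, hmm, hge⟩ := hl
  have h₁ : manVote I N M m ≤ 1 := manVote_le_one
  have h₂ : womanVote I N M w ≤ 1 := womanVote_le_one
  by_cases h' : (m, w) ∈ M
  · have := hMl m w h'
    simp [manVote, womanVote, this, not_manPrefers_of_mem hM hN h' h,
      not_manPrefers_of_mem hN hM h h', not_womanPrefers_of_mem hM hN h' h,
      not_womanPrefers_of_mem hN hM h h']
  have hge' := hge m w (hN.1 h)
  by_cases hlt : lA m < lB w
  · omega
  by_cases hs : lB w + 1 = lA m
  · obtain ⟨-, -, ⟨w', hw', hp⟩, m', hm', hq⟩ := hmm m w (hN.1 h) hs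
    have h₃ := manVote_of_prefA hM hN h hw' hp
    have h₄ := womanVote_of_prefB hM hN h hm' hq
    omega
  · have := manVote_or_womanVote_of_not_plusPlus hM hN h h' fun hp => hlt (hpp m w hp)
    omega

end Votes

end CritInstance

/-- If `M` is a feasible matching and some level assignment satisfies the
dominant conditions for `M`, then `M` is a popular feasible matching, i.e.
`φ(N,M) ≤ φ(M,N)` for every feasible matching `N`. -/
theorem domConds_isPFM {A : Type u} {B : Type v} [Fintype A] [Fintype B]
    (I : CritInstance A B) (M : Finset (A × B)) (hM : I.IsFeasible M)
    (lA : A → ℕ) (lB : B → ℕ) (h : I.DomConds M lA lB) :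
    I.IsPFM M := by
  refine ⟨hM, fun N hN => ?_⟩
  obtain ⟨hMl, hmu, hwu, hC, -⟩ := id h
  set f : A → ℤ := fun m => if CritInstance.ManMatched M m then 2 * (lA m : ℤ) - 1 else 0
    with hf
  set g : B → ℤ := fun w => if CritInstance.WomanMatched M w then 1 - 2 * (lB w : ℤ) else 0
    with hg
  have hf' : ∀ m, f m ≤ 2 * (lA m : ℤ) - 1 := by
    intro m
    by_cases hm : CritInstance.ManMatched M m
    · simp [hf, hm]
    · simp [hf, hm, hmu m hm]
  have hg' : ∀ w, g w ≤ 1 - 2 * (lB w : ℤ) := by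
    intro w
    by_cases hw : CritInstance.WomanMatched M w
    · simp [hg, hw]
    · simp [hg, hw, hwu w hw]
  have hfg := hM.1.sum_add_sum_nonpos (fun m => -f m) (fun w => -g w)
    (fun m hm => by simp [hf, hm]) (fun w hw => by simp [hg, hw]) (fun m w hmw => by
      have h₁ : CritInstance.ManMatched M m := ⟨w, hmw⟩
      have h₂ : CritInstance.WomanMatched M w := ⟨m, hmw⟩
      simp [hf, hg, h₁, h₂, hMl m w hmw])
  have hvote := hN.1.sum_add_sum_nonpos
    (fun m => CritInstance.manVote I N M m + f m)
    (fun w => CritInstance.womanVote I N M w + g w)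
    (fun m hm => by
      by_cases hm' : CritInstance.ManMatched M m
      · have h₁ := hC m fun hc => hm (hN.2 m hc)
        have h₂ := hf' m
        have h₃ := CritInstance.manVote_of_not_matched (I := I) hm hm'
        omega
      · simp [hf, hm', CritInstance.manVote_of_not_matched_of_not_matched (I := I) hm hm'])
    (fun w hw => by
      by_cases hw' : CritInstance.WomanMatched M w
      · have h₂ := hg' w
        have h₃ := CritInstance.womanVote_of_not_matched (I := I) hw hw'
        omega
      · simp [hg, hw', CritInstance.womanVote_of_not_matched_of_not_matched (I := I) hw hw'])
    (fun m w hmw => by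
      have h₁ := h.manVote_add_womanVote_le hM.1 hN.1 hmw
      have h₂ := hf' m
      have h₃ := hg' w
      omega)
  have hphi := CritInstance.sum_manVote_add_sum_womanVote I N M
  simp only [Finset.sum_add_distrib, Finset.sum_neg_distrib] at hfg hvote
  omega
end

section
/- In a marriage instance with critical men, a matching M is a dominant feasible matching if and only if M is feasible and there exists a level assignment satisfying the dominant conditions for M. -/
open Classical

universe u v

/-! ### Potentials of a weighted digraph without positive permutations -/

section Potential

variable {V : Type*}

/-- `PathEnd arc (x :: l) s`: the list read backwards is a simple path ending at `x`, along arcs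
of total weight `s`. -/
inductive PathEnd (arc : V → V → ℤ → Prop) : List V → ℤ → Prop
  | single (x : V) : PathEnd arc [x] 0
  | cons {x y : V} {l : List V} {s k : ℤ} : PathEnd arc (x :: l) s → arc x y k →
      y ∉ x :: l → PathEnd arc (y :: x :: l) (s + k)

theorem PathEnd.nodup {arc : V → V → ℤ → Prop} {l : List V} {s : ℤ} (h : PathEnd arc l s) :
    l.Nodup := by
  induction h with
  | single x => simp
  | cons _ _ hy ih => exact List.nodup_cons.2 ⟨hy, ih⟩

theorem PathEnd.le_length {arc : V → V → ℤ → Prop} (harc : ∀ x y k, arc x y k → k ≤ 1)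
    {l : List V} {s : ℤ} (h : PathEnd arc l s) : s ≤ l.length := by
  induction h with
  | single x => simp
  | cons _ ha _ ih =>
    have := harc _ _ _ ha
    push_cast [List.length_cons] at ih ⊢
    linarith

/-- Splitting a simple path at a vertex `y` on it: an initial part ending at `y`, and a
permutation following the rest of the path from `y` to its end `x` and sending `x` to `y`. -/
theorem PathEnd.exists_perm [Fintype V] {arc : V → V → ℤ → Prop} {l : List V} {s : ℤ}
    (h : PathEnd arc l s) : ∀ y ∈ l, ∃ l₂ s₂, PathEnd arc (y :: l₂) s₂ ∧
      ∃ (σ : Equiv.Perm V) (κ : V → ℤ), (∀ x ∈ l.head?, σ x = y ∧ κ x = 0 ∧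
        ∀ z ≠ x, (σ z = z ∧ κ z = 0) ∨ arc z (σ z) (κ z)) ∧
        (∀ z ∉ l, σ z = z ∧ κ z = 0) ∧ ∑ z, κ z = s - s₂ := by
  induction h with
  | single x =>
    intro y hy
    obtain rfl : y = x := by simpa using hy
    exact ⟨[], 0, .single y, 1, 0, by simp⟩
  | @cons x x' l s k hp ha hx' ih =>
    intro y hy
    rcases List.mem_cons.1 hy with rfl | hy
    · exact ⟨x :: l, s + k, .cons hp ha hx', 1, 0, by simp⟩
    · obtain ⟨l₂, s₂, hp₂, σ, κ, h1, h2, h3⟩ := ih y hy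
      obtain ⟨hσx, hκx, hv⟩ := h1 x (by simp)
      have hne : x' ≠ x := fun h => hx' (by simp [h])
      refine ⟨l₂, s₂, hp₂, σ * Equiv.swap x x', Function.update κ x k, ?_, ?_, ?_⟩
      · intro a hxa
        obtain rfl : x' = a := by simpa using hxa
        refine ⟨by simp [hσx], by simp [hne, (h2 x' hx').2], ?_⟩
        intro z hz
        by_cases hzx : z = x
        · subst hzx
          right
          simpa [(h2 x' hx').1] using ha
        · simpa [Function.update_of_ne hzx, Equiv.swap_apply_of_ne_of_ne hzx hz] using hv z hzx
      · intro z hz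
        simp only [List.mem_cons, not_or] at hz
        have := h2 z (by simp [hz])
        simpa [Function.update_of_ne hz.2.1, Equiv.swap_apply_of_ne_of_ne hz.2.1 hz.1] using this
      · have hsum : ∑ z, Function.update κ x k z = ∑ z, (κ z + if z = x then k else 0) := by
          refine Finset.sum_congr rfl fun z _ => ?_
          by_cases hzx : z = x
          · subst hzx; simp [hκx]
          · simp [hzx]
        rw [hsum, Finset.sum_add_distrib, h3]
        simp
        ring

/-- If no permutation along the arcs has positive weight then the digraph has a potential. -/
theorem exists_potential [Fintype V] (arc : V → V → ℤ → Prop) (harc : ∀ x y k, arc x y k → k ≤ 1)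
    (H : ∀ (σ : Equiv.Perm V) (κ : V → ℤ),
      (∀ x, (σ x = x ∧ κ x = 0) ∨ arc x (σ x) (κ x)) → ∑ x, κ x ≤ 0) :
    ∃ p : V → ℤ, ∀ x y k, arc x y k → p x + k ≤ p y := by
  have key : ∀ y, ∃ b, (∃ l, PathEnd arc (y :: l) b) ∧
      ∀ s, (∃ l, PathEnd arc (y :: l) s) → s ≤ b := by
    intro y
    refine Int.exists_greatest_of_bdd ⟨(Fintype.card V : ℤ), ?_⟩ ⟨0, [], .single y⟩
    rintro s ⟨l, hl⟩
    exact (hl.le_length harc).trans (by exact_mod_cast hl.nodup.length_le_card)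
  choose p hp hmax using key
  refine ⟨p, fun x y k hk => ?_⟩
  obtain ⟨l, hl⟩ := hp x
  by_cases hy : y ∈ x :: l
  · obtain ⟨l₂, s₂, hp₂, σ, κ, h1, h2, h3⟩ := hl.exists_perm y hy
    obtain ⟨hσx, hκx, hv⟩ := h1 x (by simp)
    have hs := hmax y s₂ ⟨l₂, hp₂⟩
    have := H σ (fun z => κ z + if z = x then k else 0) (by
      intro z
      by_cases hz : z = x
      · subst hz
        right
        simpa [hσx, hκx] using hk
      · simpa [hz] using hv z hz)
    rw [Finset.sum_add_distrib, h3] at this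
    simp at this
    linarith
  · exact hmax y _ ⟨x :: l, .cons hl hk hy⟩

end Potential

theorem indicator_le_of_imp {P Q : Prop} [Decidable P] [Decidable Q] (h : P → Q) :
    (if P then (1 : ℤ) else 0) ≤ if Q then 1 else 0 := by
  by_cases hP : P
  · rw [if_pos hP, if_pos (h hP)]
  · rw [if_neg hP]
    split_ifs <;> norm_num

/-- The label at a vertex with partners `M` of the edge to its neighbour `y` (zero on `M`). -/
noncomputable def edgeLabel {Y : Type*} (M : Y → Prop) (pref : Y → Y → Prop) (y : Y) : ℤ :=
  if M y then 0 else if (¬ ∃ y, M y) ∨ ∃ y', M y' ∧ pref y y' then 1 else -1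

/-- The vote of one vertex between its partners under `N` and `M`, as a sum of labels. -/
theorem vote_eq_sum_labels {Y : Type*} [Fintype Y] (M N : Y → Prop) (pref : Y → Y → Prop)
    (irrefl : ∀ y, ¬ pref y y) (trans : ∀ x y z, pref x y → pref y z → pref x z)
    (hM : ∀ y y', M y → M y' → y = y') (hN : ∀ y y', N y → N y' → y = y')
    (total : ∀ y y', M y → N y' → y ≠ y' → pref y y' ∨ pref y' y)
    {P Q R : Prop} [DecidablePred N] [Decidable P] [Decidable Q] [Decidable R]
    (hP : P ↔ ∃ y, N y ∧ ((¬ ∃ y, M y) ∨ ∃ y', M y' ∧ pref y y'))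
    (hQ : Q ↔ ∃ y, M y ∧ ((¬ ∃ y, N y) ∨ ∃ y', N y' ∧ pref y y'))
    (hR : R ↔ (∃ y, M y) ∧ ¬ ∃ y, N y) :
    ((if P then 1 else 0) - (if Q then 1 else 0) : ℤ) =
      (∑ y, if N y then edgeLabel M pref y else 0) - (if R then 1 else 0) := by
  simp only [hP, hQ, hR, edgeLabel]
  by_cases h : ∃ y, N y
  · obtain ⟨n, hn⟩ := h
    have hNiff : ∀ y, N y ↔ y = n := fun y => ⟨fun h => hN _ _ h hn, fun h => h ▸ hn⟩
    by_cases h' : ∃ y, M y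
    · obtain ⟨m, hm⟩ := h'
      have hMiff : ∀ y, M y ↔ y = m := fun y => ⟨fun h => hM _ _ h hm, fun h => h ▸ hm⟩
      by_cases hmn : m = n
      · subst hmn
        simp [hNiff, hMiff, irrefl]
      · have hasymm : ¬ (pref m n ∧ pref n m) := fun h => irrefl _ (trans _ _ _ h.1 h.2)
        have ht := total m n hm hn hmn
        have hnm : ¬ n = m := fun h => hmn h.symm
        by_cases h1 : pref m n
        · have h2 : ¬ pref n m := fun h => hasymm ⟨h1, h⟩
          simp [hNiff, hMiff, h1, h2, hnm]
        · have h2 : pref n m := ht.resolve_left h1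
          simp [hNiff, hMiff, h1, h2, hnm]
    · have hM0 : ∀ y, ¬ M y := fun y hy => h' ⟨y, hy⟩
      simp [hNiff, hM0]
  · have hN0 : ∀ y, ¬ N y := fun y hy => h ⟨y, hy⟩
    simp [hN0]

namespace CritInstance

variable {A : Type u} {B : Type v}

/-- Half of the sum of the two labels of an edge (zero on `M`). -/
noncomputable def halfWeight (I : CritInstance A B) (M : Finset (A × B)) (m : A) (w : B) : ℤ :=
  if PlusPlus I M m w then 1 else if MinusMinus I M m w then -1 else 0

theorem halfWeight_le_one (I : CritInstance A B) (M : Finset (A × B)) (m : A) (w : B) :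
    halfWeight I M m w ≤ 1 := by
  unfold halfWeight
  split_ifs <;> norm_num

theorem halfWeight_of_mem (I : CritInstance A B) {M : Finset (A × B)} {m : A} {w : B}
    (h : (m, w) ∈ M) : halfWeight I M m w = 0 := by
  simp [halfWeight, PlusPlus, MinusMinus, h]

theorem labels_eq_halfWeight {I : CritInstance A B} {M : Finset (A × B)} (hM : IsMatching I M)
    {m : A} {w : B} (he : (m, w) ∈ I.E) :
    edgeLabel (fun w => (m, w) ∈ M) (I.prefA m) w + edgeLabel (fun m => (m, w) ∈ M) (I.prefB w) m =
    2 * halfWeight I M m w := by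
  by_cases h : (m, w) ∈ M
  · simp [edgeLabel, h, halfWeight_of_mem]
  have hA : ((¬ ∃ w, (m, w) ∈ M) ∨ ∃ w', (m, w') ∈ M ∧ I.prefA m w w') ↔
      ¬ ∃ w', (m, w') ∈ M ∧ I.prefA m w' w := by
    constructor
    · rintro (h1 | ⟨w', h1, h2⟩) ⟨w'', h3, h4⟩
      · exact h1 ⟨_, h3⟩
      · obtain rfl := hM.2.1 h1 h3
        exact I.prefA_irrefl _ _ (I.prefA_trans _ _ _ _ h2 h4)
    · intro h1
      by_cases h2 : ∃ w, (m, w) ∈ M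
      · obtain ⟨w', h2⟩ := h2
        rcases I.prefA_total m w w' he (hM.1 h2) (by rintro rfl; exact h h2) with h3 | h3
        · exact Or.inr ⟨w', h2, h3⟩
        · exact absurd ⟨w', h2, h3⟩ h1
      · exact Or.inl h2
  have hB : ((¬ ∃ m, (m, w) ∈ M) ∨ ∃ m', (m', w) ∈ M ∧ I.prefB w m m') ↔
      ¬ ∃ m', (m', w) ∈ M ∧ I.prefB w m' m := by
    constructor
    · rintro (h1 | ⟨m', h1, h2⟩) ⟨m'', h3, h4⟩
      · exact h1 ⟨_, h3⟩
      · obtain rfl := hM.2.2 h1 h3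
        exact I.prefB_irrefl _ _ (I.prefB_trans _ _ _ _ h2 h4)
    · intro h1
      by_cases h2 : ∃ m, (m, w) ∈ M
      · obtain ⟨m', h2⟩ := h2
        rcases I.prefB_total w m m' he (hM.1 h2) (by rintro rfl; exact h h2) with h3 | h3
        · exact Or.inr ⟨m', h2, h3⟩
        · exact absurd ⟨m', h2, h3⟩ h1
      · exact Or.inl h2
  simp only [edgeLabel, halfWeight, PlusPlus, MinusMinus, ManMatched, WomanMatched, hA, hB]
  by_cases a : ∃ w', (m, w') ∈ M ∧ I.prefA m w' w <;>
    by_cases b : ∃ m', (m', w) ∈ M ∧ I.prefB w m' m <;>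
    simp only [h, he, a, b, not_true, not_false_iff, if_true, if_false, and_true, and_false] <;> norm_num

section Counting

variable [Fintype A] [Fintype B]

theorem sum_sum_ite_mem (N : Finset (A × B)) (f : A → B → ℤ) :
    ∑ m, ∑ w, (if (m, w) ∈ N then f m w else 0) = ∑ e ∈ N, f e.1 e.2 := by
  rw [← Fintype.sum_prod_type' (f := fun m w => if (m, w) ∈ N then f m w else 0)]
  simp

theorem sum_fst {I : CritInstance A B} {N : Finset (A × B)} (hN : IsMatching I N) (f : A → ℤ) :
    ∑ e ∈ N, f e.1 = ∑ m, if ManMatched N m then f m else 0 := by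
  rw [← sum_sum_ite_mem N (fun m _ => f m)]
  refine Finset.sum_congr rfl fun m _ => ?_
  by_cases h : ManMatched N m
  · obtain ⟨w, hw⟩ := h
    rw [if_pos ⟨w, hw⟩, Finset.sum_eq_single w, if_pos hw]
    · exact fun w' _ hne => if_neg fun h => hne (hN.2.1 h hw)
    · simp
  · rw [if_neg h]
    exact Finset.sum_eq_zero fun w _ => if_neg fun hw => h ⟨w, hw⟩

theorem sum_snd {I : CritInstance A B} {N : Finset (A × B)} (hN : IsMatching I N) (f : B → ℤ) :
    ∑ e ∈ N, f e.2 = ∑ w, if WomanMatched N w then f w else 0 := by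
  rw [← sum_sum_ite_mem N (fun _ w => f w), Finset.sum_comm]
  refine Finset.sum_congr rfl fun w _ => ?_
  by_cases h : WomanMatched N w
  · obtain ⟨m, hm⟩ := h
    rw [if_pos ⟨m, hm⟩, Finset.sum_eq_single m, if_pos hm]
    · exact fun m' _ hne => if_neg fun h => hne (hN.2.2 h hm)
    · simp
  · rw [if_neg h]
    exact Finset.sum_eq_zero fun m _ => if_neg fun hm => h ⟨m, hm⟩

theorem card_eq_sum_men {I : CritInstance A B} {N : Finset (A × B)} (hN : IsMatching I N) :
    (N.card : ℤ) = ∑ m : A, if ManMatched N m then 1 else 0 := by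
  rw [← sum_fst hN (fun _ => 1)]
  simp

theorem card_eq_sum_women {I : CritInstance A B} {N : Finset (A × B)} (hN : IsMatching I N) :
    (N.card : ℤ) = ∑ w : B, if WomanMatched N w then 1 else 0 := by
  rw [← sum_snd hN (fun _ => 1)]
  simp

/-- The margin of `N` over `M` in terms of the edge weights of `N` with respect to `M`. -/
theorem phi_sub_phi {I : CritInstance A B} {M N : Finset (A × B)} (hM : IsMatching I M)
    (hN : IsMatching I N) :
    (phi I N M : ℤ) - phi I M N = 2 * ∑ e ∈ N, halfWeight I M e.1 e.2 -
      (∑ m : A, if ManMatched M m ∧ ¬ ManMatched N m then 1 else 0) -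
      (∑ w : B, if WomanMatched M w ∧ ¬ WomanMatched N w then 1 else 0) := by
  have hmen := fun m : A =>
    vote_eq_sum_labels (fun w => (m, w) ∈ M) (fun w => (m, w) ∈ N) (I.prefA m)
      (I.prefA_irrefl m) (I.prefA_trans m) (fun _ _ h h' => hM.2.1 h h')
      (fun _ _ h h' => hN.2.1 h h') (fun _ _ h h' => I.prefA_total m _ _ (hM.1 h) (hN.1 h'))
      (P := ManPrefers I N M m) (Q := ManPrefers I M N m)
      (R := ManMatched M m ∧ ¬ ManMatched N m) Iff.rfl Iff.rfl Iff.rfl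
  have hwomen := fun w : B =>
    vote_eq_sum_labels (fun m => (m, w) ∈ M) (fun m => (m, w) ∈ N) (I.prefB w)
      (I.prefB_irrefl w) (I.prefB_trans w) (fun _ _ h h' => hM.2.2 h h')
      (fun _ _ h h' => hN.2.2 h h') (fun _ _ h h' => I.prefB_total w _ _ (hM.1 h) (hN.1 h'))
      (P := WomanPrefers I N M w) (Q := WomanPrefers I M N w)
      (R := WomanMatched M w ∧ ¬ WomanMatched N w) Iff.rfl Iff.rfl Iff.rfl
  have hA := Finset.sum_congr (rfl : (Finset.univ : Finset A) = _) fun m _ => hmen m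
  have hB := Finset.sum_congr (rfl : (Finset.univ : Finset B) = _) fun w _ => hwomen w
  rw [Finset.sum_sub_distrib, Finset.sum_sub_distrib,
    sum_sum_ite_mem N (fun m w => edgeLabel (fun w => (m, w) ∈ M) (I.prefA m) w)] at hA
  rw [Finset.sum_sub_distrib, Finset.sum_sub_distrib, Finset.sum_comm,
    sum_sum_ite_mem N (fun m w => edgeLabel (fun m => (m, w) ∈ M) (I.prefB w) m)] at hB
  have hE : ∑ e ∈ N, 2 * halfWeight I M e.1 e.2 = _ :=
    Finset.sum_congr rfl fun e he => (labels_eq_halfWeight hM (hN.1 he)).symm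
  rw [Finset.sum_add_distrib] at hE
  rw [Finset.mul_sum, hE]
  unfold phi
  push_cast [Finset.card_filter]
  linarith

/-- With a level assignment, the margin of `N` over `M` is at most minus the number of men
matched in `N` only. -/
theorem margin_le {I : CritInstance A B} {M N : Finset (A × B)} {lA : A → ℕ} {lB : B → ℕ}
    (hM : IsFeasible I M) (hl : I.DomConds M lA lB) (hN : IsFeasible I N) :
    (phi I N M : ℤ) - phi I M N ≤
      -∑ m : A, if ManMatched N m ∧ ¬ ManMatched M m then 1 else 0 := by
  obtain ⟨hpart, hman, hwoman, hcrit, hpp, hmm, hsteep⟩ := hl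
  have hedge : ∑ e ∈ N, halfWeight I M e.1 e.2 ≤ ∑ e ∈ N, ((lB e.2 : ℤ) - lA e.1) := by
    refine Finset.sum_le_sum fun e he => ?_
    have h1 := hpp e.1 e.2
    have h2 := hmm e.1 e.2 (hN.1.1 he)
    have h3 := hsteep e.1 e.2 (hN.1.1 he)
    unfold halfWeight
    split_ifs with ha hb
    · have := h1 ha
      omega
    · omega
    · have : ¬ (lB e.2 + 1 = lA e.1) := fun h => hb (h2 h)
      omega
  have hzero : ∑ e ∈ M, ((lB e.2 : ℤ) - lA e.1) = 0 :=
    Finset.sum_eq_zero fun e he => by rw [hpart e.1 e.2 he, sub_self]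
  rw [Finset.sum_sub_distrib, sum_fst hN.1 (fun m => (lA m : ℤ)),
    sum_snd hN.1 (fun w => (lB w : ℤ))] at hedge
  rw [Finset.sum_sub_distrib, sum_fst hM.1 (fun m => (lA m : ℤ)),
    sum_snd hM.1 (fun w => (lB w : ℤ))] at hzero
  have hmen : ∑ m : A, (-2 * (if ManMatched N m then (lA m : ℤ) else 0) -
        (if ManMatched M m ∧ ¬ ManMatched N m then 1 else 0)) ≤
      ∑ m : A, (-2 * (if ManMatched M m then (lA m : ℤ) else 0) +
        ((if ManMatched M m then 1 else 0) - (if ManMatched N m then 1 else 0)) -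
        (if ManMatched N m ∧ ¬ ManMatched M m then 1 else 0)) := by
    refine Finset.sum_le_sum fun m _ => ?_
    by_cases a : ManMatched M m <;> by_cases b : ManMatched N m <;> simp [a, b]
    · have := hcrit m fun hc => b (hN.2 m hc)
      omega
    · have := hman m a
      omega
  have hwomen : ∑ w : B, (2 * (if WomanMatched N w then (lB w : ℤ) else 0) -
        (if WomanMatched M w ∧ ¬ WomanMatched N w then 1 else 0)) ≤
      ∑ w : B, (2 * (if WomanMatched M w then (lB w : ℤ) else 0) -
        ((if WomanMatched M w then 1 else 0) - (if WomanMatched N w then 1 else 0))) := by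
    refine Finset.sum_le_sum fun w _ => ?_
    by_cases a : WomanMatched M w <;> by_cases b : WomanMatched N w <;> simp [a, b]
    · omega
    · simp [hwoman w a]
  simp only [Finset.sum_sub_distrib, Finset.sum_add_distrib, ← Finset.mul_sum,
    ← card_eq_sum_men hM.1, ← card_eq_sum_men hN.1, ← card_eq_sum_women hM.1,
    ← card_eq_sum_women hN.1] at hmen hwomen
  rw [phi_sub_phi hM.1 hN.1]
  linarith

theorem isDFM_of_levels {I : CritInstance A B} {M : Finset (A × B)} {lA : A → ℕ} {lB : B → ℕ}
    (hM : IsFeasible I M) (hl : I.DomConds M lA lB) : I.IsDFM M := by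
  refine ⟨⟨hM, fun N hN => ?_⟩, fun N hN hlt => ?_⟩
  · have h := margin_le hM hl hN
    have : (0 : ℤ) ≤ ∑ m : A, if ManMatched N m ∧ ¬ ManMatched M m then 1 else 0 :=
      Finset.sum_nonneg fun m _ => by split_ifs <;> norm_num
    omega
  · have h := margin_le hM hl hN
    have : (N.card : ℤ) - M.card ≤
        ∑ m : A, if ManMatched N m ∧ ¬ ManMatched M m then 1 else 0 := by
      rw [card_eq_sum_men hN.1, card_eq_sum_men hM.1, ← Finset.sum_sub_distrib]
      refine Finset.sum_le_sum fun m _ => ?_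
      by_cases a : ManMatched M m <;> by_cases b : ManMatched N m <;> simp [a, b]
    omega

end Counting

/-- The difference constraints on the levels of the men, relative to a root `none` of level `0`
that also stands for the unmatched women: `LevelArc I M x y k` demands that the level of `y` is
at least the level of `x` plus `k`. -/
def LevelArc (I : CritInstance A B) (M : Finset (A × B)) : Option A → Option A → ℤ → Prop
  | none, none, _ => False
  | none, some m, k => (ManMatched M m ∧ k = 0) ∨ (¬ ManMatched M m ∧ k = 1)
  | some m, some m', k => ∃ w, (m', w) ∈ M ∧ (m, w) ∈ I.E ∧ k = halfWeight I M m w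
  | some m, none, k => (m ∉ I.C ∧ k = -1) ∨
      ∃ w, ¬ WomanMatched M w ∧ (m, w) ∈ I.E ∧ k = halfWeight I M m w

theorem LevelArc.le_one {I : CritInstance A B} {M : Finset (A × B)} :
    ∀ x y k, LevelArc I M x y k → k ≤ 1
  | none, none, _, h => h.elim
  | none, some _, _, h => by rcases h with h | h <;> omega
  | some m, some _, _, ⟨w, _, _, h⟩ => h ▸ halfWeight_le_one I M m w
  | some m, none, _, h => by
    rcases h with h | ⟨w, _, _, h⟩
    · omega
    · exact h ▸ halfWeight_le_one I M m w

/-- A potential for the difference constraints yields a level assignment. -/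
theorem exists_levels_of_potential {I : CritInstance A B} {M : Finset (A × B)}
    (hM : IsFeasible I M) {p : Option A → ℤ}
    (hp : ∀ x y k, LevelArc I M x y k → p x + k ≤ p y) :
    ∃ (lA : A → ℕ) (lB : B → ℕ), I.DomConds M lA lB := by
  have hnonneg : ∀ m, p none ≤ p (some m) := fun m => by
    by_cases h : ManMatched M m
    · simpa using hp none (some m) 0 (Or.inl ⟨h, rfl⟩)
    · linarith [hp none (some m) 1 (Or.inr ⟨h, rfl⟩)]
  have hle : ∀ m ∉ I.C, p (some m) ≤ p none + 1 := fun m h => by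
    linarith [hp (some m) none (-1) (Or.inl ⟨h, rfl⟩)]
  obtain ⟨lA, hlA⟩ : ∃ lA : A → ℕ, ∀ m, (lA m : ℤ) = p (some m) - p none :=
    ⟨fun m => (p (some m) - p none).toNat, fun m => Int.toNat_of_nonneg (by linarith [hnonneg m])⟩
  let lB : B → ℕ := fun w => if h : WomanMatched M w then lA h.choose else 0
  have hmatched : ∀ m w, (m, w) ∈ M → lA m = lB w := by
    intro m w h
    have hw : WomanMatched M w := ⟨m, h⟩
    simp only [lB, dif_pos hw]
    rw [hM.1.2.2 h hw.choose_spec]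
  have hunmatched : ∀ w, ¬ WomanMatched M w → lB w = 0 := fun w h => by simp [lB, h]
  have hedge : ∀ m w, (m, w) ∈ I.E → (lA m : ℤ) + halfWeight I M m w ≤ lB w := by
    intro m w he
    by_cases h : WomanMatched M w
    · obtain ⟨m', h⟩ := h
      rw [← hmatched m' w h, hlA, hlA]
      linarith [hp (some m) (some m') _ ⟨w, h, he, rfl⟩]
    · rw [hunmatched w h, hlA]
      push_cast
      linarith [hp (some m) none _ (Or.inr ⟨w, h, he, rfl⟩)]
  refine ⟨lA, lB, hmatched, fun m h => ?_, hunmatched, fun m h => ?_, fun m w h => ?_,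
    fun m w he h => ?_, fun m w he h => ?_⟩
  · have h1 := hle m fun hc => h (hM.2 m hc)
    have h2 := hp none (some m) 1 (Or.inr ⟨h, rfl⟩)
    have h3 := hlA m
    omega
  · have h1 := hle m h
    have h3 := hlA m
    omega
  · have h1 := hedge m w h.1
    rw [halfWeight, if_pos h] at h1
    omega
  · by_contra hmm
    have h1 := hedge m w he
    rw [halfWeight, if_neg hmm] at h1
    split_ifs at h1 <;> omega
  · have h1 := hedge m w he
    have : -1 ≤ halfWeight I M m w := by
      unfold halfWeight
      split_ifs <;> norm_num
    omega

/-- For a dominant feasible matching, every permutation along the constraint arcs has nonpositive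
weight: otherwise the matching it induces would contradict dominance. -/
theorem sum_perm_nonpos [Fintype A] [Fintype B] {I : CritInstance A B} {M : Finset (A × B)}
    (hM : I.IsDFM M) (σ : Equiv.Perm (Option A)) (κ : Option A → ℤ)
    (h : ∀ x, (σ x = x ∧ κ x = 0) ∨ LevelArc I M x (σ x) (κ x)) : ∑ x, κ x ≤ 0 := by
  obtain ⟨⟨hfeas, hpop⟩, hdom⟩ := hM
  have hchoice : ∀ m, ∃ t : Option B,
      (∃ m' w, σ (some m) = some m' ∧ (m', w) ∈ M ∧ (m, w) ∈ I.E ∧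
        κ (some m) = halfWeight I M m w ∧ t = some w) ∨
      (σ (some m) = some m ∧ ¬ ManMatched M m ∧ κ (some m) = 0 ∧ t = none) ∨
      (∃ w, σ (some m) = none ∧ ¬ WomanMatched M w ∧ (m, w) ∈ I.E ∧
        κ (some m) = halfWeight I M m w ∧ t = some w) ∨
      (σ (some m) = none ∧ m ∉ I.C ∧ κ (some m) = -1 ∧ t = none) := by
    intro m
    rcases h (some m) with ⟨h1, h2⟩ | h1
    · by_cases hm : ManMatched M m
      · obtain ⟨w, hw⟩ := hm
        exact ⟨some w, Or.inl ⟨m, w, h1, hw, hfeas.1.1 hw, by rw [h2, halfWeight_of_mem I hw], rfl⟩⟩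
      · exact ⟨none, Or.inr (Or.inl ⟨h1, hm, h2, rfl⟩)⟩
    · cases hs : σ (some m) with
      | some m' =>
        rw [hs] at h1
        obtain ⟨w, a, b, c⟩ := h1
        exact ⟨some w, Or.inl ⟨m', w, rfl, a, b, c, rfl⟩⟩
      | none =>
        rw [hs] at h1
        rcases h1 with ⟨a, b⟩ | ⟨w, a, b, c⟩
        · exact ⟨none, Or.inr (Or.inr (Or.inr ⟨rfl, a, b, rfl⟩))⟩
        · exact ⟨some w, Or.inr (Or.inr (Or.inl ⟨w, rfl, a, b, c, rfl⟩))⟩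
  choose τ hτ using hchoice
  let N : Finset (A × B) := Finset.univ.filter fun e => τ e.1 = some e.2
  have hmem : ∀ m w, (m, w) ∈ N ↔ τ m = some w := fun m w => by simp [N]
  have hmanN : ∀ m, ManMatched N m ↔ τ m ≠ none := fun m => by
    simp [ManMatched, hmem, Option.ne_none_iff_exists']
  have hN : IsFeasible I N := by
    refine ⟨⟨?_, ?_, ?_⟩, ?_⟩
    · rintro ⟨m, w⟩ he
      rw [hmem] at he
      have := hτ m
      grind
    · intro m w w' h1 h2
      rw [hmem] at h1 h2
      exact Option.some.inj (h1.symm.trans h2)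
    · intro m m' w h1 h2
      rw [hmem] at h1 h2
      have key : σ (some m) = σ (some m') := by
        rcases hτ m with ⟨a, v, a1, a2, a3, a4, a5⟩ | ⟨a1, a2, a3, a4⟩ | ⟨v, a1, a2, a3, a4, a5⟩ |
            ⟨a1, a2, a3, a4⟩ <;>
          rcases hτ m' with ⟨b, u, b1, b2, b3, b4, b5⟩ | ⟨b1, b2, b3, b4⟩ |
            ⟨u, b1, b2, b3, b4, b5⟩ | ⟨b1, b2, b3, b4⟩
        all_goals first
          | (rw [h1] at a4; cases a4)
          | (rw [h2] at b4; cases b4)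
          | skip
        all_goals
          obtain rfl : w = v := Option.some.inj (h1.symm.trans a5)
          obtain rfl : w = u := Option.some.inj (h2.symm.trans b5)
        · rw [a1, b1, hfeas.1.2.2 a2 b2]
        · exact absurd ⟨_, a2⟩ b2
        · exact absurd ⟨_, b2⟩ a2
        · rw [a1, b1]
      exact Option.some.inj (σ.injective key)
    · intro m hm
      rw [hmanN]
      have h1 := hfeas.2 m hm
      rcases hτ m with ⟨a, v, a1, a2, a3, a4, a5⟩ | ⟨a1, a2, a3, a4⟩ | ⟨v, a1, a2, a3, a4, a5⟩ |
        ⟨a1, a2, a3, a4⟩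
      · simp [a5]
      · exact absurd h1 a2
      · simp [a5]
      · exact absurd hm a2
  have hsum : ∑ e ∈ N, halfWeight I M e.1 e.2 =
      ∑ m, κ (some m) + ∑ m, if τ m = none ∧ σ (some m) = none then 1 else 0 := by
    rw [← sum_sum_ite_mem N (halfWeight I M), ← Finset.sum_add_distrib]
    refine Finset.sum_congr rfl fun m _ => ?_
    simp only [hmem]
    rcases hτ m with ⟨a, v, a1, a2, a3, a4, a5⟩ | ⟨a1, a2, a3, a4⟩ | ⟨v, a1, a2, a3, a4, a5⟩ |
      ⟨a1, a2, a3, a4⟩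
    · simp [a5, a4]
    · simp [a4, a3, a1]
    · simp [a5, a4]
    · simp [a4, a3, a1]
  have hlostA : (∑ m : A, if ManMatched M m ∧ ¬ ManMatched N m then (1 : ℤ) else 0) ≤
      ∑ m, if τ m = none ∧ σ (some m) = none then 1 else 0 := by
    refine Finset.sum_le_sum fun m _ => ?_
    have : ManMatched M m ∧ ¬ ManMatched N m → τ m = none ∧ σ (some m) = none := by
      rw [hmanN]
      have := hτ m
      grind
    exact indicator_le_of_imp this
  have hlostB : ∀ m w, (m, w) ∈ M → ¬ WomanMatched N w → σ none = some m := by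
    intro m w hmw hw
    cases hx : σ.symm (some m) with
    | none => rw [← hx, Equiv.apply_symm_apply]
    | some m₁ =>
      have hm₁ : σ (some m₁) = some m := by rw [← hx, Equiv.apply_symm_apply]
      exfalso
      apply hw
      refine ⟨m₁, ?_⟩
      rw [hmem]
      rcases hτ m₁ with ⟨a, v, a1, a2, a3, a4, a5⟩ | ⟨a1, a2, a3, a4⟩ |
        ⟨v, a1, a2, a3, a4, a5⟩ | ⟨a1, a2, a3, a4⟩
      · obtain rfl : m = a := Option.some.inj (hm₁.symm.trans a1)
        rw [a5, hfeas.1.2.1 a2 hmw]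
      · obtain rfl : m = m₁ := Option.some.inj (hm₁.symm.trans a1)
        exact absurd ⟨w, hmw⟩ a2
      · simp [hm₁] at a1
      · simp [hm₁] at a1
  have hmargin := phi_sub_phi hfeas.1 hN.1
  have hle := hpop N hN
  rw [hsum] at hmargin
  rw [Fintype.sum_option]
  set D : ℤ := ∑ m, if τ m = none ∧ σ (some m) = none then 1 else 0 with hD
  cases hroot : σ none with
  | none =>
    have hW : (∑ w : B, if WomanMatched M w ∧ ¬ WomanMatched N w then (1 : ℤ) else 0) = 0 := by
      refine Finset.sum_eq_zero fun w _ => if_neg ?_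
      rintro ⟨⟨m, hm⟩, hw⟩
      simpa [hroot] using hlostB m w hm hw
    have hκ : κ none = 0 := by
      have := h none
      rw [hroot] at this
      exact this.elim (fun h => h.2) (fun h => h.elim)
    have hDn : D = 0 := by
      refine Finset.sum_eq_zero fun m _ => if_neg ?_
      rintro ⟨-, hm⟩
      simpa using σ.injective (hm.trans hroot.symm)
    omega
  | some m₀ =>
    have hDn : 0 ≤ D := Finset.sum_nonneg fun m _ => by split_ifs <;> norm_num
    have hκ := h none
    rw [hroot] at hκ
    replace hκ := hκ.resolve_left (by simp)
    rcases hκ with ⟨hm₀, hκ⟩ | ⟨hm₀, hκ⟩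
    · obtain ⟨w₀, hw₀⟩ := hm₀
      have hW : (∑ w : B, if WomanMatched M w ∧ ¬ WomanMatched N w then (1 : ℤ) else 0) ≤
          ∑ w : B, if w = w₀ then 1 else 0 := by
        refine Finset.sum_le_sum fun w _ => ?_
        have : WomanMatched M w ∧ ¬ WomanMatched N w → w = w₀ := by
          rintro ⟨⟨m, hm⟩, hw⟩
          obtain rfl : m₀ = m := Option.some.inj (hroot.symm.trans (hlostB m w hm hw))
          exact hfeas.1.2.1 hm hw₀
        exact indicator_le_of_imp this
      simp only [Finset.sum_ite_eq', Finset.mem_univ, if_true] at hW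
      omega
    · have hW : (∑ w : B, if WomanMatched M w ∧ ¬ WomanMatched N w then (1 : ℤ) else 0) = 0 := by
        refine Finset.sum_eq_zero fun w _ => if_neg ?_
        rintro ⟨⟨m, hm⟩, hw⟩
        obtain rfl : m₀ = m := Option.some.inj (hroot.symm.trans (hlostB m w hm hw))
        exact hm₀ ⟨w, hm⟩
      by_cases hDz : ∃ m, τ m = none ∧ σ (some m) = none
      · obtain ⟨m, hm⟩ := hDz
        have : 1 ≤ D := by
          refine le_trans (le_of_eq (if_pos hm).symm) (Finset.single_le_sum
            (f := fun m => if τ m = none ∧ σ (some m) = none then (1 : ℤ) else 0)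
            (fun m _ => ?_) (Finset.mem_univ m))
          split_ifs <;> norm_num
        omega
      · have hm₀N : ManMatched N m₀ := by
          rw [hmanN]
          intro hnone
          rcases hτ m₀ with ⟨a, v, a1, a2, a3, a4, a5⟩ | ⟨a1, a2, a3, a4⟩ |
            ⟨v, a1, a2, a3, a4, a5⟩ | ⟨a1, a2, a3, a4⟩
          · simp [hnone] at a5
          · simpa using σ.injective (a1.trans hroot.symm)
          · simp [hnone] at a5
          · exact hDz ⟨m₀, a4, a1⟩
        have hkeep : ∀ m, ManMatched M m → ManMatched N m := by
          intro m hm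
          rw [hmanN]
          have := hτ m
          grind
        have hcard : M.card < N.card := by
          zify
          rw [card_eq_sum_men hfeas.1, card_eq_sum_men hN.1]
          refine Finset.sum_lt_sum (fun m _ => ?_) ⟨m₀, Finset.mem_univ _, ?_⟩
          · by_cases a : ManMatched M m
            · simp [a, hkeep m a]
            · rw [if_neg a]
              split_ifs <;> norm_num
          · simp [hm₀, hm₀N]
        have := hdom N hN hcard
        omega

end CritInstance

/-- A matching `M` is a dominant feasible matching if and only if `M` is
feasible and some level assignment satisfies the dominant conditions for `M`. -/
theorem isDFM_iff_levels {A : Type u} {B : Type v} [Fintype A] [Fintype B]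
    (I : CritInstance A B) (M : Finset (A × B)) :
    I.IsDFM M ↔
      (I.IsFeasible M ∧ ∃ (lA : A → ℕ) (lB : B → ℕ), I.DomConds M lA lB) := by
  constructor
  · intro hM
    obtain ⟨p, hp⟩ := exists_potential (CritInstance.LevelArc I M)
      CritInstance.LevelArc.le_one (CritInstance.sum_perm_nonpos hM)
    exact ⟨hM.1.1, CritInstance.exists_levels_of_potential hM.1.1 hp⟩
  · rintro ⟨hM, lA, lB, hl⟩
    exact CritInstance.isDFM_of_levels hM hl
end
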